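/- arXiv:1609.07663 — 11 statements merged into one kernel-verified Lean document; each statement's English description precedes it below -/
import Mathlib

section
/- The polynomial P(s,t) = (s−2)(s+1)²·t⁴ − (s−2)(s+2)(s+1)·t² − 1 is irreducible in the polynomial ring ℂ[s,t]. -/
open MvPolynomial

/-- If the constant coefficient is nonzero, irreducibility can be tested on the reverse. -/
theorem Polynomial.irreducible_of_reverse {R : Type*} [CommRing R] [IsDomain R]
    {f : Polynomial R} (h0 : f.coeff 0 ≠ 0) (hf : Irreducible f.reverse) : Irreducible f := by
  have isUnit_of_reverse : ∀ g : Polynomial R, g.coeff 0 ≠ 0 → IsUnit g.reverse → IsUnit g := by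
    intro g hg hu
    have hd : g.natDegree = 0 := by
      rw [g.natDegree_eq_reverse_natDegree_add_natTrailingDegree,
        Polynomial.natDegree_eq_zero_of_isUnit hu,
        Polynomial.natTrailingDegree_eq_zero.mpr (Or.inr hg)]
    rw [Polynomial.eq_C_of_natDegree_eq_zero hd] at hu ⊢
    rwa [Polynomial.reverse_C] at hu
  refine ⟨fun hu => hf.not_isUnit ?_, fun g h hgh => ?_⟩
  · obtain ⟨c, -, rfl⟩ := Polynomial.isUnit_iff.mp hu
    rwa [Polynomial.reverse_C]
  · subst hgh
    rw [Polynomial.mul_coeff_zero] at h0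
    rw [Polynomial.reverse_mul_of_domain] at hf
    exact (hf.isUnit_or_isUnit rfl).imp
      (isUnit_of_reverse g (left_ne_zero_of_mul h0)) (isUnit_of_reverse h (right_ne_zero_of_mul h0))

/-- The derivatives of a polynomial in the square of the ideal of a point vanish at that point. -/
theorem MvPolynomial.eval_pderiv_eq_zero_of_mem_ker_sq {σ R : Type*} [CommRing R]
    (x : σ → R) (i : σ) {p : MvPolynomial σ R} (hp : p ∈ RingHom.ker (eval x) ^ 2) :
    eval x (pderiv i p) = 0 := by
  rw [pow_two] at hp
  induction hp using Submodule.mul_induction_on' with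
  | mem_mul_mem a ha b hb =>
    rw [RingHom.mem_ker] at ha hb
    simp [Derivation.leibniz, ha, hb]
  | add a _ b _ ha hb => simp [ha, hb]

/-- A quartic that is Eisenstein at `s = 2`. -/
theorem irreducible_eisenstein_quartic :
    Irreducible (Polynomial.X ^ 4
      + Polynomial.C ((X 0 - 2) * (X 0 + 2) * (X 0 + 1)) * Polynomial.X ^ 2
      - Polynomial.C ((X 0 - 2) * (X 0 + 1) ^ 2) : Polynomial (MvPolynomial (Fin 1) ℂ)) := by
  set f : Polynomial (MvPolynomial (Fin 1) ℂ) := Polynomial.X ^ 4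
      + Polynomial.C ((X 0 - 2) * (X 0 + 2) * (X 0 + 1)) * Polynomial.X ^ 2
      - Polynomial.C ((X 0 - 2) * (X 0 + 1) ^ 2) with hf
  have hdeg : f.natDegree = 4 := by rw [hf]; compute_degree!
  have hmonic : f.Monic := by rw [hf]; monicity!
  have hprime : (RingHom.ker (eval (fun _ : Fin 1 => (2 : ℂ)))).IsPrime := RingHom.ker_isPrime _
  refine Polynomial.IsEisensteinAt.irreducible (𝓟 := RingHom.ker (eval (fun _ => (2 : ℂ))))
    ⟨?_, ?_, ?_⟩ hprime hmonic.isPrimitive (by omega)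
  · rw [hmonic.leadingCoeff]
    simp
  · intro n hn
    rw [hdeg] at hn
    rw [RingHom.mem_ker, hf]
    interval_cases n <;> simp [Polynomial.coeff_X_pow, Polynomial.coeff_C, -map_mul, -map_sub,
      -map_add, Polynomial.coeff_C_mul] <;> simp
  · intro h
    have := MvPolynomial.eval_pderiv_eq_zero_of_mem_ker_sq _ 0 h
    have hc : f.coeff 0 = -((X 0 - 2) * (X 0 + 1) ^ 2) := by
      rw [hf, Polynomial.coeff_sub, Polynomial.coeff_C_zero]
      simp
    have h2 : pderiv (0 : Fin 1) (2 : MvPolynomial (Fin 1) ℂ) = 0 := pderiv_C (a := 2)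
    rw [hc] at this
    norm_num [Derivation.leibniz, h2] at this

/-- The polynomial `P(s,t) = (s−2)(s+1)²·t⁴ − (s−2)(s+2)(s+1)·t² − 1` is irreducible
in `ℂ[s,t]`, where `s = X 0` and `t = X 1`. -/
theorem stmt_0 :
    Irreducible ((X 0 - 2) * (X 0 + 1) ^ 2 * (X 1) ^ 4
      - (X 0 - 2) * (X 0 + 2) * (X 0 + 1) * (X 1) ^ 2 - 1 :
      MvPolynomial (Fin 2) ℂ) := by
  let e := (renameEquiv ℂ (Equiv.swap (0 : Fin 2) 1)).trans (finSuccEquiv ℂ 1)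
  have h0 : e (X 0) = Polynomial.C (X 0) := by
    simpa [e] using finSuccEquiv_X_succ (R := ℂ) (j := (0 : Fin 1))
  have h1 : e (X 1) = Polynomial.X := by simp [e, finSuccEquiv_X_zero]
  rw [← MulEquiv.irreducible_iff e]
  set a : MvPolynomial (Fin 1) ℂ := (X 0 - 2) * (X 0 + 1) ^ 2 with ha
  set b : MvPolynomial (Fin 1) ℂ := (X 0 - 2) * (X 0 + 2) * (X 0 + 1) with hb
  have he : e ((X 0 - 2) * (X 0 + 1) ^ 2 * (X 1) ^ 4
      - (X 0 - 2) * (X 0 + 2) * (X 0 + 1) * (X 1) ^ 2 - 1) =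
      Polynomial.C a * Polynomial.X ^ 4 - Polynomial.C b * Polynomial.X ^ 2 - 1 := by
    simp [h0, h1, ha, hb, map_ofNat e 2, map_ofNat Polynomial.C 2]
  rw [he]
  have ha0 : a ≠ 0 := by
    intro h
    have := congrArg (eval fun _ => (1 : ℂ)) h
    norm_num [ha] at this
  refine Polynomial.irreducible_of_reverse (by simp) ?_
  have hdeg : (Polynomial.C a * Polynomial.X ^ 4 - Polynomial.C b * Polynomial.X ^ 2 - 1 :
      Polynomial (MvPolynomial (Fin 1) ℂ)).natDegree = 4 := by compute_degree!
  have hrev : (Polynomial.C a * Polynomial.X ^ 4 - Polynomial.C b * Polynomial.X ^ 2 - 1 :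
      Polynomial (MvPolynomial (Fin 1) ℂ)).reverse =
      -(Polynomial.X ^ 4 + Polynomial.C b * Polynomial.X ^ 2 - Polynomial.C a) := by
    rw [Polynomial.reverse, hdeg, Polynomial.reflect_sub, Polynomial.reflect_sub,
      Polynomial.reflect_C_mul_X_pow, Polynomial.reflect_C_mul_X_pow, Polynomial.reflect_one]
    norm_num [Polynomial.revAt_le]
    ring
  rw [hrev]
  exact (Associated.refl _).neg_left.irreducible_iff.mpr irreducible_eisenstein_quartic
end

section
/- If s and t are real numbers satisfying P(s,t) = 0, then t ≠ 0, s ≠ −1, s ≠ 2, and (s − 2)·(s³ + 2s² − 4s − 4) ≥ 0. -/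
/-- If real numbers `s, t` satisfy `P(s,t) = 0`, where
`P(s,t) = (s−2)(s+1)²t⁴ − (s−2)(s+2)(s+1)t² − 1`, then `t ≠ 0`, `s ≠ −1`, `s ≠ 2`,
and `(s − 2)(s³ + 2s² − 4s − 4) ≥ 0`. -/
theorem stmt_4 (s t : ℝ)
    (hP : (s - 2) * (s + 1) ^ 2 * t ^ 4 - (s - 2) * (s + 2) * (s + 1) * t ^ 2 - 1 = 0) :
    t ≠ 0 ∧ s ≠ -1 ∧ s ≠ 2 ∧ (s - 2) * (s ^ 3 + 2 * s ^ 2 - 4 * s - 4) ≥ 0 := by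
  refine ⟨?_, ?_, ?_, ?_⟩
  · rintro rfl
    norm_num at hP
  · rintro rfl
    norm_num at hP
  · rintro rfl
    norm_num at hP
  · have discrim_eq_sq : (s - 2) * (s ^ 3 + 2 * s ^ 2 - 4 * s - 4) =
        (2 * (s - 2) * ((s + 1) * t ^ 2) - (s - 2) * (s + 2)) ^ 2 := by
      linear_combination -4 * (s - 2) * hP
    rw [discrim_eq_sq]
    positivity
end

section
/- Let s and t be real numbers with P(s,t) = 0 (so t ≠ 0 and s ≠ −1), and set w = t − 1/(t(s+1)). Then the inequality (2w − st)² ≤ (4 − s²)(4 − t²) holds if and only if (s+1)³(s−2)·t² ≤ 0 (equivalently, if and only if −1 < s < 2). -/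
/-- For real `s, t` with `P(s,t) = 0` and `w = t − 1/(t(s+1))`, the inequality
`(2w − st)² ≤ (4 − s²)(4 − t²)` holds iff `(s+1)³(s−2)t² ≤ 0`, equivalently iff
`−1 < s < 2`. -/
theorem stmt_7 (s t w : ℝ)
    (hP : (s - 2) * (s + 1) ^ 2 * t ^ 4 - (s - 2) * (s + 2) * (s + 1) * t ^ 2 - 1 = 0)
    (hw : w = t - 1 / (t * (s + 1))) :
    ((2 * w - s * t) ^ 2 ≤ (4 - s ^ 2) * (4 - t ^ 2) ↔
        (s + 1) ^ 3 * (s - 2) * t ^ 2 ≤ 0) ∧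
      ((2 * w - s * t) ^ 2 ≤ (4 - s ^ 2) * (4 - t ^ 2) ↔ (-1 < s ∧ s < 2)) := by
  have ht : t ≠ 0 := by rintro rfl; norm_num at hP
  have hs : s + 1 ≠ 0 := by intro h; rw [h] at hP; norm_num at hP
  have hs₂ : s - 2 ≠ 0 := by intro h; rw [h] at hP; norm_num at hP
  have key : (2 * w - s * t) ^ 2 - (4 - s ^ 2) * (4 - t ^ 2) = 4 * ((s + 1) * (s - 2)) := by
    rw [hw]
    field_simp
    linear_combination (-4) * hP
  have hle : (2 * w - s * t) ^ 2 ≤ (4 - s ^ 2) * (4 - t ^ 2) ↔ (s + 1) * (s - 2) ≤ 0 := by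
    constructor <;> intro h <;> linarith
  rw [hle]
  constructor
  · have hpos : 0 < (s + 1) ^ 2 * t ^ 2 := by positivity
    rw [show (s + 1) ^ 3 * (s - 2) * t ^ 2
      = ((s + 1) ^ 2 * t ^ 2) * ((s + 1) * (s - 2)) by ring]
    exact ⟨fun h => mul_nonpos_of_nonneg_of_nonpos hpos.le h,
      fun h => nonpos_of_mul_nonpos_right h hpos⟩
  · constructor
    · intro h
      have hlt : (s + 1) * (s - 2) < 0 := lt_of_le_of_ne h (mul_ne_zero hs hs₂)
      constructor <;> nlinarith
    · rintro ⟨h₁, h₂⟩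
      nlinarith
end

section
/- Let s and t be real numbers with P(s,t) = 0, and set w = t − 1/(t(s+1)). If |s| < 2 then (2w − st)² ≤ (4 − s²)(4 − t²), while if |s| > 2 then (2w − st)² > (4 − s²)(4 − t²). -/
/-- On the curve `P(s,t) = 0`, with `w = t − 1/(t(s+1))`, the discriminant-type difference
`(2w − st)² − (4 − s²)(4 − t²)` equals `4(s − 2)(s + 1)`. -/
theorem sq_sub_eq_of_curve {s t w : ℝ}
    (hP : (s - 2) * (s + 1) ^ 2 * t ^ 4 - (s - 2) * (s + 2) * (s + 1) * t ^ 2 - 1 = 0)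
    (hw : w = t - 1 / (t * (s + 1))) :
    (2 * w - s * t) ^ 2 - (4 - s ^ 2) * (4 - t ^ 2) = 4 * ((s - 2) * (s + 1)) := by
  have hne : t * (s + 1) ≠ 0 := by
    intro h
    have : (-1 : ℝ) = 0 := by
      linear_combination hP - ((s - 2) * (s + 1) * t ^ 3 - (s - 2) * (s + 2) * t) * h
    norm_num at this
  obtain ⟨r, hr⟩ : ∃ r, r = 1 / (t * (s + 1)) := ⟨_, rfl⟩
  have hinv : t * (s + 1) * r = 1 := by rw [hr, mul_one_div_cancel hne]
  have hsq : r ^ 2 = (s - 2) * t ^ 2 - (s - 2) * (s + 2) * (t * r) := by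
    linear_combination -r ^ 2 * hP + ((s - 2) * t ^ 2 * (t * (s + 1) * r + 1)
      - (s - 2) * (s + 2) * (t * r)) * hinv
  rw [← hr] at hw
  subst hw
  linear_combination 4 * hsq - 4 * (s - 2) * hinv

/-- The curve `P(s,t) = 0` has no real points with `-2 ≤ s ≤ -1`. -/
theorem neg_one_lt_of_curve {s t : ℝ}
    (hP : (s - 2) * (s + 1) ^ 2 * t ^ 4 - (s - 2) * (s + 2) * (s + 1) * t ^ 2 - 1 = 0)
    (hs : -2 ≤ s) : -1 < s := by
  by_contra! h
  have h₁ : 0 ≤ (2 - s) * ((s + 1) ^ 2 * t ^ 4) :=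
    mul_nonneg (by linarith) (by positivity)
  have h₂ : 0 ≤ (2 - s) * (s + 2) * (-(s + 1)) * t ^ 2 :=
    mul_nonneg (mul_nonneg (mul_nonneg (by linarith) (by linarith)) (by linarith)) (sq_nonneg t)
  linarith

/-- For real `s, t` with `P(s,t) = 0` and `w = t − 1/(t(s+1))`:
if `|s| < 2` then `(2w − st)² ≤ (4 − s²)(4 − t²)`, and if `|s| > 2` then
`(2w − st)² > (4 − s²)(4 − t²)`. -/
theorem stmt_8 (s t w : ℝ)
    (hP : (s - 2) * (s + 1) ^ 2 * t ^ 4 - (s - 2) * (s + 2) * (s + 1) * t ^ 2 - 1 = 0)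
    (hw : w = t - 1 / (t * (s + 1))) :
    (|s| < 2 → (2 * w - s * t) ^ 2 ≤ (4 - s ^ 2) * (4 - t ^ 2)) ∧
      (|s| > 2 → (2 * w - s * t) ^ 2 > (4 - s ^ 2) * (4 - t ^ 2)) := by
  have key := sq_sub_eq_of_curve hP hw
  refine ⟨fun h => ?_, fun h => ?_⟩
  · obtain ⟨h₁, h₂⟩ := abs_lt.mp h
    have h₃ := neg_one_lt_of_curve hP h₁.le
    have := mul_nonneg (sub_nonneg.mpr h₂.le) (by linarith : 0 ≤ s + 1)
    linarith
  · have : 0 < (s - 2) * (s + 1) := by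
      rcases lt_abs.mp h with h | h
      · exact mul_pos (by linarith) (by linarith)
      · exact mul_pos_of_neg_of_neg (by linarith) (by linarith)
    linarith
end

section
/- For every integer n′ ≥ 2 and every real number z with 0 < z < 1 and B(z) ≤ 0, one has A(z)·(z^{4n′−1} − 1) − B(z)·z^{2n′−4} > 0. -/
/-- `A(z) = z⁷ + 2z⁶ + 3z⁵ + z⁴ − z³ − 3z² − 2z − 1`. -/
noncomputable def A (z : ℝ) : ℝ :=
  z ^ 7 + 2 * z ^ 6 + 3 * z ^ 5 + z ^ 4 - z ^ 3 - 3 * z ^ 2 - 2 * z - 1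

/-- `B(z) = z¹⁴ + 3z¹³ + 2z¹² + z¹¹ − 2z¹⁰ − 4z⁹ − z⁸ − 4z⁷ − z⁶ − 4z⁵ − 2z⁴ + z³ + 2z² + 3z + 1`. -/
noncomputable def B (z : ℝ) : ℝ :=
  z ^ 14 + 3 * z ^ 13 + 2 * z ^ 12 + z ^ 11 - 2 * z ^ 10 - 4 * z ^ 9 - z ^ 8 -
    4 * z ^ 7 - z ^ 6 - 4 * z ^ 5 - 2 * z ^ 4 + z ^ 3 + 2 * z ^ 2 + 3 * z + 1

theorem A_neg {z : ℝ} (hz0 : 0 < z) (hz1 : z < 1) : A z < 0 := by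
  have hfac : A z =
      (z - 1) * (z ^ 6 + 3 * z ^ 5 + 6 * z ^ 4 + 7 * z ^ 3 + 6 * z ^ 2 + 3 * z + 1) := by
    unfold A
    ring
  rw [hfac]
  exact mul_neg_of_neg_of_pos (sub_neg.mpr hz1) (by positivity)

/-- For every integer `n′ ≥ 2` and every real `z` with `0 < z < 1` and `B(z) ≤ 0`,
one has `A(z)(z^{4n′−1} − 1) − B(z) z^{2n′−4} > 0`. -/
theorem stmt_12 (n' : ℤ) (hn : 2 ≤ n') (z : ℝ) (hz0 : 0 < z) (hz1 : z < 1)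
    (hB : B z ≤ 0) :
    A z * (z ^ (4 * n' - 1) - 1) - B z * z ^ (2 * n' - 4) > 0 := by
  have hpow : z ^ (4 * n' - 1) < 1 := by
    lift 4 * n' - 1 to ℕ using by lia with m hm
    rw [zpow_natCast]
    exact pow_lt_one₀ hz0.le hz1 (by lia)
  have hA : 0 < A z * (z ^ (4 * n' - 1) - 1) :=
    mul_pos_of_neg_of_neg (A_neg hz0 hz1) (sub_neg.mpr hpow)
  have hBz : B z * z ^ (2 * n' - 4) ≤ 0 :=
    mul_nonpos_of_nonpos_of_nonneg hB (zpow_nonneg hz0.le _)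
  linarith
end

section
/- For every real number ρ with 0 < ρ < 1, there exists an integer N such that for all integers n′ ≥ N and all real z with 0 < |z| ≤ ρ, one has A(z)·(z^{4n′−1} − 1) − B(z)·z^{2n′−4} > 0. -/
theorem A_eq_mul (z : ℝ) : A z = (z - 1) * (z ^ 2 + z + 1) ^ 3 := by
  unfold A
  ring

theorem A_le_of_le {ρ z : ℝ} (hρ1 : ρ < 1) (hz : z ≤ ρ) : A z ≤ -(27 / 64 * (1 - ρ)) := by
  have hq : (3 / 4 : ℝ) ≤ z ^ 2 + z + 1 := by nlinarith [sq_nonneg (z + 1 / 2)]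
  have hq3 : (27 / 64 : ℝ) ≤ (z ^ 2 + z + 1) ^ 3 := by
    calc (27 / 64 : ℝ) = (3 / 4) ^ 3 := by norm_num
      _ ≤ _ := by gcongr
  rw [A_eq_mul]
  nlinarith [mul_le_mul hq3 (show 1 - ρ ≤ 1 - z by linarith) (by linarith) (by linarith)]

theorem abs_B_le_of_abs_le_one {z : ℝ} (hz : |z| ≤ 1) : |B z| ≤ 32 := by
  have h (k : ℕ) : -1 ≤ z ^ k ∧ z ^ k ≤ 1 := by
    rw [← abs_le, abs_pow]
    exact pow_le_one₀ (abs_nonneg z) hz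
  obtain ⟨hl, hu⟩ := forall_and.1 h
  have hz' := abs_le.1 hz
  unfold B
  rw [abs_le]
  constructor <;>
    linarith [hz'.1, hz'.2, hl 2, hu 2, hl 3, hu 3, hl 4, hu 4, hl 5, hu 5, hl 6, hu 6, hl 7, hu 7,
      hl 8, hu 8, hl 9, hu 9, hl 10, hu 10, hl 11, hu 11, hl 12, hu 12, hl 13, hu 13, hl 14, hu 14]

theorem abs_zpow_le_pow_of_abs_le {ρ z : ℝ} (hρ1 : ρ ≤ 1) (hz : |z| ≤ ρ) {M : ℕ} {k : ℤ}
    (hk : (M : ℤ) ≤ k) : |z ^ k| ≤ ρ ^ M := by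
  lift k to ℕ using by omega
  rw [zpow_natCast, abs_pow]
  calc |z| ^ k ≤ |z| ^ M :=
        pow_le_pow_of_le_one (abs_nonneg z) (hz.trans hρ1) (by exact_mod_cast hk)
    _ ≤ ρ ^ M := by gcongr

/-- For every `0 < ρ < 1` there is an integer `N` such that for all integers `n′ ≥ N`
and all real `z` with `0 < |z| ≤ ρ`, one has
`A(z)(z^{4n′−1} − 1) − B(z) z^{2n′−4} > 0`. -/
theorem stmt_13 (ρ : ℝ) (hρ0 : 0 < ρ) (hρ1 : ρ < 1) :
    ∃ N : ℤ, ∀ n' : ℤ, N ≤ n' → ∀ z : ℝ, 0 < |z| → |z| ≤ ρ →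
      A z * (z ^ (4 * n' - 1) - 1) - B z * z ^ (2 * n' - 4) > 0 := by
  obtain ⟨M, hM⟩ := exists_pow_lt_of_lt_one (show 0 < (1 - ρ) / 200 by linarith) hρ1
  refine ⟨M + 4, fun n' hn z _ hz => ?_⟩
  have ht := abs_zpow_le_pow_of_abs_le hρ1.le hz (M := M) (k := 4 * n' - 1) (by omega)
  have hs := abs_zpow_le_pow_of_abs_le hρ1.le hz (M := M) (k := 2 * n' - 4) (by omega)
  have hA := A_le_of_le hρ1 ((le_abs_self z).trans hz)
  have hBs : B z * z ^ (2 * n' - 4) ≤ 32 * ρ ^ M :=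
    calc B z * z ^ (2 * n' - 4) ≤ |B z| * |z ^ (2 * n' - 4)| :=
          (le_abs_self _).trans_eq (abs_mul _ _)
      _ ≤ 32 * ρ ^ M := by
          gcongr
          exact abs_B_le_of_abs_le_one (hz.trans hρ1.le)
  have ht' : z ^ (4 * n' - 1) ≤ 1 / 2 := by linarith [le_abs_self (z ^ (4 * n' - 1))]
  nlinarith [mul_nonneg (show 0 ≤ -A z by linarith) (sub_nonneg.2 ht')]
end

section
/- Let p₁ be the smallest real root of the cubic s³ + 2s² − 4s − 4. There exists an integer N such that for all integers n′ ≥ N and all real numbers z with z ≠ 0, z ≠ 1, satisfying either z > 0 or z + 1/z ≤ p₁, one has A(z)·(z^{4n′−1} − 1) − B(z)·z^{2n′−4} > 0; in particular the equation −A(z) − B(z)·z^{2n′−4} + A(z)·z^{4n′−1} = 0 has no real solution z in this set when n′ ≥ N. -/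
theorem A_pos_of_one_lt {z : ℝ} (hz : 1 < z) : 0 < A z := by
  have h : A z = (z - 1) * (z ^ 2 + z + 1) ^ 3 := by unfold A; ring
  rw [h]
  have := sub_pos.2 hz
  positivity

theorem A_neg_of_lt_one {z : ℝ} (hz : z < 1) : A z < 0 := by
  have h : A z = (z - 1) * (z ^ 2 + z + 1) ^ 3 := by unfold A; ring
  rw [h]
  have : 0 < z ^ 2 + z + 1 := by nlinarith [sq_nonneg (2 * z + 1)]
  exact mul_neg_of_neg_of_pos (sub_neg.2 hz) (by positivity)

theorem B_lt_of_one_lt {z : ℝ} (hz : 1 < z) : B z < A z * (z ^ 9 - 1) := by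
  obtain ⟨t, ht, rfl⟩ : ∃ t : ℝ, 0 < t ∧ z = 1 + t := ⟨z - 1, by linarith, by ring⟩
  rw [← sub_pos]
  unfold A B
  ring_nf
  positivity

theorem B_lt_of_le_neg_two {z : ℝ} (hz : z ≤ -2) : B z < A z * z ^ 9 := by
  obtain ⟨t, ht, rfl⟩ : ∃ t : ℝ, 0 ≤ t ∧ z = -2 - t := ⟨-2 - z, by linarith, by ring⟩
  rw [← sub_pos]
  unfold A B
  ring_nf
  positivity

theorem pos_of_outside (j : ℕ) {w : ℝ} (hw : 1 < w ∨ w ≤ -2) :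
    0 < A w * (w ^ (4 * j + 11) - 1) - B w * w ^ (2 * j + 2) := by
  have hw2 : 1 ≤ w ^ 2 := by rcases hw with h | h <;> nlinarith
  have hq : 1 ≤ w ^ (2 * j) := by rw [pow_mul]; exact one_le_pow₀ hw2
  have hP : 1 ≤ w ^ (2 * j + 2) := by rw [pow_add]; exact one_le_mul_of_one_le_of_one_le hq hw2
  have hsplit : w ^ (4 * j + 11) = w ^ (2 * j + 2) * w ^ (2 * j) * w ^ 9 := by ring
  rw [hsplit]
  generalize w ^ (2 * j) = q at *
  generalize w ^ (2 * j + 2) = P at *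
  have hP0 : 0 < P := by linarith
  rcases hw with h | h
  · have hA := A_pos_of_one_lt h
    have hB := mul_lt_mul_of_pos_left (B_lt_of_one_lt h) hP0
    have h1 : 0 ≤ P * (q - 1) * (A w * w ^ 9) := by
      have : 0 ≤ q - 1 := by linarith
      have : 0 < w := by linarith
      positivity
    have h2 : 0 ≤ A w * (P - 1) := mul_nonneg hA.le (by linarith)
    linarith
  · have hA := A_neg_of_lt_one (show w < 1 by linarith)
    have hB := mul_lt_mul_of_pos_left (B_lt_of_le_neg_two h) hP0
    have hAw : 0 ≤ A w * w ^ 9 :=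
      mul_nonneg_of_nonpos_of_nonpos hA.le (Odd.pow_nonpos (by decide) (by linarith))
    have h1 : 0 ≤ P * (q - 1) * (A w * w ^ 9) := by
      have : 0 ≤ q - 1 := by linarith
      positivity
    linarith

theorem expr_eq_inv (j : ℕ) {z : ℝ} (hz : z ≠ 0) :
    A z * (z ^ (4 * j + 11) - 1) - B z * z ^ (2 * j + 2) =
      z ^ (4 * j + 18) *
        (A z⁻¹ * (z⁻¹ ^ (4 * j + 11) - 1) - B z⁻¹ * z⁻¹ ^ (2 * j + 2)) := by
  obtain ⟨w, hw⟩ : ∃ w, w = z⁻¹ := ⟨_, rfl⟩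
  have hA : A z = -(z ^ 7 * A w) := by subst hw; unfold A; field_simp; ring
  have hB : B z = z ^ 14 * B w := by subst hw; unfold B; field_simp; ring
  have h1 : z ^ (4 * j + 11) * w ^ (4 * j + 11) = 1 := by
    rw [← mul_pow, hw, mul_inv_cancel₀ hz, one_pow]
  have h2 : z ^ (2 * j + 2) * w ^ (2 * j + 2) = 1 := by
    rw [← mul_pow, hw, mul_inv_cancel₀ hz, one_pow]
  rw [← hw, hA, hB]
  linear_combination (-(z ^ 7 * A w)) * h1 + (z ^ (2 * j + 16) * B w) * h2

theorem pos_of_outside_or_inv (j : ℕ) {z : ℝ} (hz : z ≠ 0)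
    (h : (1 < z ∨ z ≤ -2) ∨ (1 < z⁻¹ ∨ z⁻¹ ≤ -2)) :
    0 < A z * (z ^ (4 * j + 11) - 1) - B z * z ^ (2 * j + 2) := by
  rcases h with h | h
  · exact pos_of_outside j h
  · rw [expr_eq_inv j hz]
    have he : Even (4 * j + 18) := ⟨2 * j + 9, by ring⟩
    exact mul_pos (he.pow_pos hz) (pos_of_outside j h)

theorem exists_cubic_root_le :
    ∃ x : ℝ, x ≤ -5 / 2 ∧ x ^ 3 + 2 * x ^ 2 - 4 * x - 4 = 0 := by
  have hc : ContinuousOn (fun x : ℝ => x ^ 3 + 2 * x ^ 2 - 4 * x - 4) (Set.Icc (-3) (-5 / 2)) := by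
    fun_prop
  obtain ⟨x, hx, hx0⟩ := intermediate_value_Icc (by norm_num) hc
    (show (0 : ℝ) ∈ Set.Icc _ _ by constructor <;> norm_num)
  exact ⟨x, hx.2, hx0⟩

theorem le_neg_two_or_inv_le {z : ℝ} (hz : z < 0) (h : z + z⁻¹ ≤ -5 / 2) :
    z ≤ -2 ∨ z⁻¹ ≤ -2 := by
  by_contra! hc
  have h1 : z * z⁻¹ = 1 := mul_inv_cancel₀ hz.ne
  nlinarith [mul_pos (show 0 < z + 2 by linarith) (show 0 < z⁻¹ + 2 by linarith)]

/-- Let `p₁` be the smallest real root of `s³ + 2s² − 4s − 4`. Then there is an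
integer `N` such that for all integers `n′ ≥ N` and all real `z ≠ 0, 1` with
`z > 0` or `z + 1/z ≤ p₁`, one has `A(z)(z^{4n′−1} − 1) − B(z) z^{2n′−4} > 0`;
in particular `−A(z) − B(z) z^{2n′−4} + A(z) z^{4n′−1} ≠ 0` for such `z`. -/
theorem stmt_14 (p₁ : ℝ)
    (hroot : p₁ ^ 3 + 2 * p₁ ^ 2 - 4 * p₁ - 4 = 0)
    (hmin : ∀ x : ℝ, x ^ 3 + 2 * x ^ 2 - 4 * x - 4 = 0 → p₁ ≤ x) :
    ∃ N : ℤ, ∀ n' : ℤ, N ≤ n' → ∀ z : ℝ, z ≠ 0 → z ≠ 1 →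
      (0 < z ∨ z + 1 / z ≤ p₁) →
      A z * (z ^ (4 * n' - 1) - 1) - B z * z ^ (2 * n' - 4) > 0 ∧
        -A z - B z * z ^ (2 * n' - 4) + A z * z ^ (4 * n' - 1) ≠ 0 := by
  obtain ⟨x, hx, hx0⟩ := exists_cubic_root_le
  have hp : p₁ ≤ -5 / 2 := (hmin x hx0).trans hx
  refine ⟨3, fun n hn z hz0 hz1 hz => ?_⟩
  obtain ⟨j, hj⟩ := Int.eq_ofNat_of_zero_le (sub_nonneg.2 hn)
  have e1 : 4 * n - 1 = ((4 * j + 11 : ℕ) : ℤ) := by push_cast; omega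
  have e2 : 2 * n - 4 = ((2 * j + 2 : ℕ) : ℤ) := by push_cast; omega
  have key : 0 < A z * (z ^ (4 * n - 1) - 1) - B z * z ^ (2 * n - 4) := by
    rw [e1, e2, zpow_natCast, zpow_natCast]
    apply pos_of_outside_or_inv j hz0
    rcases lt_or_gt_of_ne hz0 with hneg | hpos
    · have hs : z + z⁻¹ ≤ -5 / 2 := by
        rcases hz with h | h
        · linarith
        · rw [one_div] at h; linarith
      rcases le_neg_two_or_inv_le hneg hs with h | h
      · exact Or.inl (Or.inr h)
      · exact Or.inr (Or.inr h)
    · rcases lt_or_gt_of_ne hz1 with h | h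
      · exact Or.inr (Or.inl ((one_lt_inv₀ hpos).2 h))
      · exact Or.inl (Or.inl h)
  exact ⟨key, fun h => by linarith⟩
end

section
/- For every integer n ≥ 2, there exists a real number z with 0 < z < 1 such that A(z)·(z^{4n+1} − 1) + B(z)·z^{2n−3} = 0. -/
/-- For every integer `n ≥ 2` there exists a real `z ∈ (0, 1)` with
`A(z)(z^{4n+1} − 1) + B(z) z^{2n−3} = 0`. -/
theorem stmt_15 (n : ℤ) (hn : 2 ≤ n) :
    ∃ z : ℝ, 0 < z ∧ z < 1 ∧
      A z * (z ^ (4 * n + 1) - 1) + B z * z ^ (2 * n - 3) = 0 := by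
  obtain ⟨m, rfl⟩ := Int.le.dest hn
  have h₁ : (4 * (2 + (m : ℤ)) + 1) = ((4 * m + 9 : ℕ) : ℤ) := by push_cast; ring
  have h₂ : (2 * (2 + (m : ℤ)) - 3) = ((2 * m + 1 : ℕ) : ℤ) := by push_cast; ring
  simp only [h₁, h₂, zpow_natCast]
  have hcont : ContinuousOn
      (fun z : ℝ => A z * (z ^ (4 * m + 9) - 1) + B z * z ^ (2 * m + 1)) (Set.Icc 0 1) := by
    unfold A B
    fun_prop
  obtain ⟨z, ⟨hz₀, hz₁⟩, hz⟩ := intermediate_value_Ioo' zero_le_one hcont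
    (show (0 : ℝ) ∈ Set.Ioo _ _ by constructor <;> norm_num [A, B])
  exact ⟨z, hz₀, hz₁, hz⟩
end

section
/- The set of real points {(s,t) ∈ ℝ² : P(s,t) = 0} has exactly six connected components. -/
open Set Topology

/-- If a continuous map to a discrete space separates connected components, then the number of
connected components is the cardinality of its range. -/
theorem natCard_connectedComponents_eq_ncard_range {X Y : Type*} [TopologicalSpace X]
    [TopologicalSpace Y] [DiscreteTopology Y] {f : X → Y} (hf : Continuous f)
    (h : ∀ x y, f x = f y → x ∈ connectedComponent y) :
    Nat.card (ConnectedComponents X) = (range f).ncard := by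
  have hinj : Function.Injective hf.connectedComponentsLift := by
    intro p q hpq
    obtain ⟨x, rfl⟩ := ConnectedComponents.surjective_coe p
    obtain ⟨y, rfl⟩ := ConnectedComponents.surjective_coe q
    rw [hf.connectedComponentsLift_apply_coe, hf.connectedComponentsLift_apply_coe] at hpq
    exact ConnectedComponents.coe_eq_coe'.2 (h x y hpq)
  have hrange : range f = range hf.connectedComponentsLift := by
    rw [← ConnectedComponents.surjective_coe.range_comp hf.connectedComponentsLift,
      hf.connectedComponentsLift_comp_coe]
  rw [hrange, ← Nat.card_coe_set_eq, Nat.card_range_of_injective hinj]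

theorem IsPreconnected.mem_connectedComponent_subtype {X : Type*} [TopologicalSpace X]
    {S T : Set X} (hT : IsPreconnected T) (hTS : T ⊆ S) {x y : S} (hx : (x : X) ∈ T)
    (hy : (y : X) ∈ T) : x ∈ connectedComponent y := by
  have hT' : IsPreconnected ((↑) ⁻¹' T : Set S) := by
    rw [← IsInducing.subtypeVal.isPreconnected_image, Subtype.image_preimage_coe,
      inter_eq_right.2 hTS]
    exact hT
  exact hT'.subset_connectedComponent hy hx

namespace M137

/-- The real locus of the geometric component of the character variety of `m137`. -/
def realLocus : Set (ℝ × ℝ) :=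
  {p | (p.1 - 2) * (p.1 + 1) ^ 2 * p.2 ^ 4 -
    (p.1 - 2) * (p.1 + 2) * (p.1 + 1) * p.2 ^ 2 - 1 = 0}

/-- The discriminant of the equation `w² - (s + 2) w - 1 / (s - 2) = 0`, which `w = (s + 1) t²`
satisfies on the real locus. -/
noncomputable def disc (s : ℝ) : ℝ := (s + 2) ^ 2 + 4 / (s - 2)

/-- The roots of `w² - (s + 2) w - 1 / (s - 2) = 0`, for `σ = ± 1`. -/
noncomputable def root (σ s : ℝ) : ℝ := (s + 2 + σ * √(disc s)) / 2

/-- The four branches of the real locus over the `s`-axis, for `ε = ± 1` and `σ = ± 1`. -/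
noncomputable def branch (ε σ s : ℝ) : ℝ × ℝ := (s, ε * √(root σ s / (s + 1)))

theorem disc_mul {s : ℝ} (hs : s ≠ 2) : disc s * (s - 2) = s ^ 3 + 2 * s ^ 2 - 4 * s - 4 := by
  have : s - 2 ≠ 0 := sub_ne_zero.2 hs
  unfold disc
  field_simp
  ring

theorem continuousOn_branch (ε σ : ℝ) {I : Set ℝ} (h1 : ∀ s ∈ I, s ≠ -1) (h2 : ∀ s ∈ I, s ≠ 2) :
    ContinuousOn (branch ε σ) I := by
  have h1' : ∀ s ∈ I, s + 1 ≠ 0 := fun s hs h => h1 s hs (by linarith)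
  have h2' : ∀ s ∈ I, s - 2 ≠ 0 := fun s hs => sub_ne_zero.2 (h2 s hs)
  unfold branch root disc
  fun_prop (disch := assumption)

theorem branch_mem_realLocus {ε σ s : ℝ} (hε : ε ^ 2 = 1) (hσ : σ ^ 2 = 1) (h1 : s ≠ -1)
    (h2 : s ≠ 2) (hD : 0 ≤ disc s) (hw : 0 ≤ root σ s / (s + 1)) :
    branch ε σ s ∈ realLocus := by
  have h1' : s + 1 ≠ 0 := fun h => h1 (by linarith)
  have h2' : s - 2 ≠ 0 := sub_ne_zero.2 h2
  have ht : (s + 1) * (ε * √(root σ s / (s + 1))) ^ 2 = root σ s := by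
    rw [mul_pow, Real.sq_sqrt hw, hε, one_mul, mul_div_cancel₀ _ h1']
  have hr : (2 * root σ s - (s + 2)) ^ 2 = disc s := by
    rw [root, mul_div_cancel₀ _ two_ne_zero, add_sub_cancel_left, mul_pow, Real.sq_sqrt hD, hσ,
      one_mul]
  have hd := disc_mul h2
  rw [← hr, ← ht] at hd
  simp only [realLocus, branch, mem_ofPred_eq]
  linear_combination hd / 4

theorem fst_ne_neg_one {p : ℝ × ℝ} (hp : p ∈ realLocus) : p.1 ≠ -1 := by
  intro h
  simp [realLocus, h] at hp

theorem fst_ne_two {p : ℝ × ℝ} (hp : p ∈ realLocus) : p.1 ≠ 2 := by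
  intro h
  simp [realLocus, h] at hp

theorem snd_ne_zero {p : ℝ × ℝ} (hp : p ∈ realLocus) : p.2 ≠ 0 := by
  intro h
  simp [realLocus, h] at hp

theorem disc_eq_sq {p : ℝ × ℝ} (hp : p ∈ realLocus) :
    disc p.1 = (2 * ((p.1 + 1) * p.2 ^ 2) - (p.1 + 2)) ^ 2 := by
  have h2 : p.1 - 2 ≠ 0 := sub_ne_zero.2 (fst_ne_two hp)
  apply mul_right_cancel₀ h2
  rw [disc_mul (fst_ne_two hp)]
  simp only [realLocus, mem_ofPred_eq] at hp
  linear_combination -4 * hp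

theorem eq_branch_of_mul_sqrt_disc {p : ℝ × ℝ} (hp : p ∈ realLocus) {σ : ℝ}
    (h : σ * √(disc p.1) = 2 * ((p.1 + 1) * p.2 ^ 2) - (p.1 + 2)) :
    p = branch (SignType.sign p.2) σ p.1 := by
  have h1 : p.1 + 1 ≠ 0 := fun h => fst_ne_neg_one hp (by linarith)
  have hr : root σ p.1 = (p.1 + 1) * p.2 ^ 2 := by
    rw [root, h]
    ring
  rw [branch, hr, mul_div_cancel_left₀ _ h1, Real.sqrt_sq_eq_abs, sign_mul_abs]

theorem eq_branch {p : ℝ × ℝ} (hp : p ∈ realLocus) :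
    p = branch (SignType.sign p.2) 1 p.1 ∨ p = branch (SignType.sign p.2) (-1) p.1 := by
  have h := congrArg Real.sqrt (disc_eq_sq hp)
  rw [Real.sqrt_sq_eq_abs] at h
  rcases abs_choice (2 * ((p.1 + 1) * p.2 ^ 2) - (p.1 + 2)) with h' | h'
  · exact .inl (eq_branch_of_mul_sqrt_disc hp (by rw [h, h', one_mul]))
  · exact .inr (eq_branch_of_mul_sqrt_disc hp (by rw [h, h']; ring))

theorem eq_branch_one_of_two_lt {p : ℝ × ℝ} (hp : p ∈ realLocus) (hs : 2 < p.1) :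
    p = branch (SignType.sign p.2) 1 p.1 := by
  have h := congrArg Real.sqrt (disc_eq_sq hp)
  rw [Real.sqrt_sq_eq_abs] at h
  have hw : 0 < (p.1 + 1) * p.2 ^ 2 := by
    have := sq_pos_of_ne_zero (snd_ne_zero hp)
    have : 0 < p.1 + 1 := by linarith
    positivity
  have hpos : 0 < 2 * ((p.1 + 1) * p.2 ^ 2) - (p.1 + 2) := by
    have hp' : (p.1 - 2) * ((p.1 + 1) * p.2 ^ 2) * ((p.1 + 1) * p.2 ^ 2 - (p.1 + 2)) = 1 := by
      simp only [realLocus, mem_ofPred_eq] at hp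
      linear_combination hp
    have := pos_of_mul_pos_right (hp' ▸ one_pos) (mul_pos (sub_pos.2 hs) hw).le
    linarith
  exact eq_branch_of_mul_sqrt_disc hp (by rw [h, abs_of_pos hpos, one_mul])

theorem disc_nonneg {p : ℝ × ℝ} (hp : p ∈ realLocus) : 0 ≤ disc p.1 :=
  disc_eq_sq hp ▸ sq_nonneg _

theorem sqrt_disc_lt {s : ℝ} (hs : s < 2) (hs' : s ≠ -2) : √(disc s) < |s + 2| := by
  rw [← Real.sqrt_sq_eq_abs]
  have : s + 2 ≠ 0 := fun h => hs' (by linarith)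
  refine (Real.sqrt_lt_sqrt_iff_of_pos (by positivity)).2 ?_
  have : 4 / (s - 2) < 0 := div_neg_of_pos_of_neg (by norm_num) (by linarith)
  unfold disc
  linarith

theorem root_div_pos_of_two_lt {s : ℝ} (hs : 2 < s) : 0 < root 1 s / (s + 1) := by
  unfold root
  have : 0 < s + 1 := by linarith
  have : 0 < s + 2 := by linarith
  positivity

theorem root_div_pos_of_lt_two {σ s : ℝ} (hσ : σ ^ 2 = 1) (hs : s < -2 ∨ -1 < s ∧ s < 2) :
    0 < root σ s / (s + 1) := by
  have hlt : |σ * √(disc s)| < |s + 2| := by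
    rw [abs_mul, (pow_eq_one_iff_of_nonneg (abs_nonneg σ) two_ne_zero).1 (by rw [sq_abs, hσ]),
      one_mul, abs_of_nonneg (Real.sqrt_nonneg _)]
    rcases hs with hs | hs
    · exact sqrt_disc_lt (by linarith) (by linarith)
    · exact sqrt_disc_lt hs.2 (by linarith)
  unfold root
  rcases hs with hs | hs
  · rw [abs_of_neg (a := s + 2) (by linarith)] at hlt
    have := (abs_lt.1 hlt).2
    exact div_pos_of_neg_of_neg (by linarith) (by linarith)
  · rw [abs_of_pos (a := s + 2) (by linarith)] at hlt
    have := (abs_lt.1 hlt).1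
    exact div_pos (by linarith) (by linarith)

theorem disc_nonneg_of_two_lt {s : ℝ} (hs : 2 < s) : 0 ≤ disc s := by
  have : 0 < s - 2 := by linarith
  unfold disc
  positivity

theorem exists_disc_mul_eq : ∃ a b c : ℝ, a < -2 ∧ -1 < b ∧ b < c ∧ c < 2 ∧
    ∀ s, s ≠ 2 → disc s * (s - 2) = (s - a) * (s - b) * (s - c) := by
  have hcont : Continuous fun s : ℝ => s ^ 3 + 2 * s ^ 2 - 4 * s - 4 := by fun_prop
  obtain ⟨b, ⟨hb1, hb2⟩, hb⟩ := intermediate_value_Ioo' (show (-1 : ℝ) ≤ 0 by norm_num)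
    hcont.continuousOn (show (0 : ℝ) ∈ Ioo _ _ by norm_num)
  obtain ⟨c, ⟨hc1, hc2⟩, hc⟩ := intermediate_value_Ioo (show (1 : ℝ) ≤ 2 by norm_num)
    hcont.continuousOn (show (0 : ℝ) ∈ Ioo _ _ by norm_num)
  refine ⟨-2 - b - c, b, c, by linarith, hb1, by linarith, hc2, fun s hs => ?_⟩
  have hbc : b ^ 2 + b * c + c ^ 2 + 2 * (b + c) - 4 = 0 := by
    apply mul_left_cancel₀ (show c - b ≠ 0 by linarith)
    simp only at hb hc
    linear_combination hc - hb
  rw [disc_mul hs]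
  simp only at hb
  linear_combination (s - b) * hbc + hb

/-- Over an interval that contains a zero of the discriminant, the two branches in a half-plane
are joined. -/
theorem isPreconnected_branches (ε : ℝ) {I : Set ℝ} (hI : IsPreconnected I)
    (h1 : ∀ s ∈ I, s ≠ -1) (h2 : ∀ s ∈ I, s ≠ 2) {e : ℝ} (he : e ∈ I) (hD : disc e = 0) :
    IsPreconnected (branch ε 1 '' I ∪ branch ε (-1) '' I) := by
  refine IsPreconnected.union (branch ε 1 e) (mem_image_of_mem _ he) ⟨e, he, ?_⟩
    (hI.image _ (continuousOn_branch ε 1 h1 h2)) (hI.image _ (continuousOn_branch ε (-1) h1 h2))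
  simp [branch, root, hD]

theorem mem_connectedComponent_of_interval {I : Set ℝ} (hI : IsPreconnected I)
    (hs : ∀ s ∈ I, s < -2 ∨ -1 < s ∧ s < 2) (hD : ∀ s ∈ I, 0 ≤ disc s)
    {e : ℝ} (he : e ∈ I) (hDe : disc e = 0) {x y : realLocus} (hx : x.1.1 ∈ I) (hy : y.1.1 ∈ I)
    (hxy : SignType.sign x.1.2 = SignType.sign y.1.2) : x ∈ connectedComponent y := by
  have h1 : ∀ s ∈ I, s ≠ -1 := fun s h => by rcases hs s h with h | h <;> linarith
  have h2 : ∀ s ∈ I, s ≠ 2 := fun s h => by rcases hs s h with h | h <;> linarith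
  have hε : ((SignType.sign x.1.2 : SignType) : ℝ) ^ 2 = 1 := by
    rcases (snd_ne_zero x.2).lt_or_gt with h | h <;> simp [h]
  have hmem : ∀ z : realLocus, z.1.1 ∈ I → (z : ℝ × ℝ) ∈
      branch (SignType.sign z.1.2) 1 '' I ∪ branch (SignType.sign z.1.2) (-1) '' I := by
    intro z hz
    exact (eq_branch z.2).imp (fun h => ⟨_, hz, h.symm⟩) fun h => ⟨_, hz, h.symm⟩
  refine (isPreconnected_branches (SignType.sign x.1.2) hI h1 h2 he
    hDe).mem_connectedComponent_subtype ?_ (hmem x hx) (hxy ▸ hmem y hy)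
  rintro _ (⟨s, h, rfl⟩ | ⟨s, h, rfl⟩) <;>
  exact branch_mem_realLocus hε (by norm_num) (h1 s h) (h2 s h) (hD s h)
    (root_div_pos_of_lt_two (by norm_num) (hs s h)).le

theorem mem_connectedComponent_of_two_lt {x y : realLocus} (hx : 2 < x.1.1) (hy : 2 < y.1.1)
    (hxy : SignType.sign x.1.2 = SignType.sign y.1.2) : x ∈ connectedComponent y := by
  have h1 : ∀ s ∈ Ioi (2 : ℝ), s ≠ -1 := fun s (h : 2 < s) => by linarith
  have h2 : ∀ s ∈ Ioi (2 : ℝ), s ≠ 2 := fun s h => ne_of_gt h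
  have hε : ((SignType.sign x.1.2 : SignType) : ℝ) ^ 2 = 1 := by
    rcases (snd_ne_zero x.2).lt_or_gt with h | h <;> simp [h]
  have hmem : ∀ z : realLocus, 2 < z.1.1 → (z : ℝ × ℝ) ∈
      branch (SignType.sign z.1.2) 1 '' Ioi 2 := fun z hz =>
    ⟨_, hz, (eq_branch_one_of_two_lt z.2 hz).symm⟩
  refine (isPreconnected_Ioi.image _ (continuousOn_branch (SignType.sign x.1.2) 1 h1
    h2)).mem_connectedComponent_subtype ?_ (hmem x hx) (hxy ▸ hmem y hy)
  rintro _ ⟨s, h, rfl⟩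
  exact branch_mem_realLocus hε (by norm_num) (h1 s h) (h2 s h) (disc_nonneg_of_two_lt h)
    (root_div_pos_of_two_lt h).le

/-- The signs of `t`, `s + 1` and `s - 2`. -/
noncomputable def signs (p : realLocus) : SignType × SignType × SignType :=
  (SignType.sign p.1.2, SignType.sign (p.1.1 + 1), SignType.sign (p.1.1 - 2))

theorem continuous_signs : Continuous signs := by
  have h : ∀ g : realLocus → ℝ, Continuous g → (∀ p, g p ≠ 0) →
      Continuous fun p => SignType.sign (g p) := fun g hg h0 =>
    continuous_iff_continuousAt.2 fun p =>
      (continuousAt_sign_of_ne_zero (h0 p)).comp hg.continuousAt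
  refine (h _ (by fun_prop) fun p => snd_ne_zero p.2).prodMk
    ((h _ (by fun_prop) fun p hp => fst_ne_neg_one p.2 (by linarith)).prodMk
      (h _ (by fun_prop) fun p hp => fst_ne_two p.2 (by linarith)))

theorem mem_connectedComponent_of_signs_eq {x y : realLocus} (h : signs x = signs y) :
    x ∈ connectedComponent y := by
  obtain ⟨a, b, c, ha, hb, hbc, hc, hD⟩ := exists_disc_mul_eq
  simp only [signs, Prod.mk.injEq] at h
  obtain ⟨ht, h1, h2⟩ := h
  rcases (fst_ne_two x.2).lt_or_gt with hx2 | hx2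
  · have hy2 : y.1.1 < 2 := by
      rw [sign_neg (sub_neg.2 hx2), eq_comm, sign_eq_neg_one_iff] at h2
      linarith
    have key : ∀ z : realLocus, z.1.1 < 2 → (z.1.1 - a) * (z.1.1 - b) * (z.1.1 - c) ≤ 0 :=
      fun z hz => by
        rw [← hD _ hz.ne]
        exact mul_nonpos_of_nonneg_of_nonpos (disc_nonneg z.2) (by linarith)
    rcases (fst_ne_neg_one x.2).lt_or_gt with hx1 | hx1
    · have hy1 : y.1.1 < -1 := by
        rw [sign_neg (by linarith), eq_comm, sign_eq_neg_one_iff] at h1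
        linarith
      have hI : ∀ z : realLocus, z.1.1 < -1 → z.1.1 ∈ Iic a := fun z hz => by
        by_contra hza
        have hza : a < z.1.1 := not_le.1 hza
        have := mul_pos (mul_pos (sub_pos.2 hza) (show 0 < b - z.1.1 by linarith))
          (show 0 < c - z.1.1 by linarith)
        linarith [key z (by linarith)]
      refine mem_connectedComponent_of_interval isPreconnected_Iic
        (fun s (hs : s ≤ a) => .inl (by linarith)) (fun s (hs : s ≤ a) => ?_) (e := a)
        self_mem_Iic ?_ (hI x hx1) (hI y hy1) ht
      · have := mul_nonneg (mul_nonneg (sub_nonneg.2 hs) (show 0 ≤ b - s by linarith))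
          (show 0 ≤ c - s by linarith)
        have := hD s (by linarith)
        refine nonneg_of_mul_nonneg_left (b := 2 - s) ?_ (by linarith)
        linarith
      · have := hD a (by linarith)
        rw [sub_self, zero_mul, zero_mul] at this
        exact (mul_eq_zero.1 this).resolve_right (by linarith)
    · have hy1 : -1 < y.1.1 := by
        rw [sign_pos (by linarith), eq_comm, sign_eq_one_iff] at h1
        linarith
      have hI : ∀ z : realLocus, -1 < z.1.1 → z.1.1 < 2 → z.1.1 ∈ Icc b c := fun z hz hz2 => by
        have hp : (z.1.1 - b) * (z.1.1 - c) ≤ 0 := by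
          refine nonpos_of_mul_nonpos_right (a := z.1.1 - a) ?_ (by linarith)
          linarith [key z hz2]
        constructor <;> by_contra! h
        · exact absurd (mul_pos_of_neg_of_neg (sub_neg.2 h)
            (show z.1.1 - c < 0 by linarith)) hp.not_gt
        · exact absurd (mul_pos (show 0 < z.1.1 - b by linarith) (sub_pos.2 h)) hp.not_gt
      refine mem_connectedComponent_of_interval isPreconnected_Icc
        (fun s hs => .inr ⟨by linarith [hs.1], by linarith [hs.2]⟩) (fun s hs => ?_) (e := b)
        (left_mem_Icc.2 hbc.le) ?_ (hI x hx1 hx2) (hI y hy1 hy2) ht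
      · have := mul_nonneg (mul_nonneg (show 0 ≤ s - a by linarith [hs.1]) (sub_nonneg.2 hs.1))
          (sub_nonneg.2 hs.2)
        have := hD s (by linarith [hs.2])
        refine nonneg_of_mul_nonneg_left (b := 2 - s) ?_ (by linarith [hs.2])
        linarith
      · have := hD b (by linarith)
        rw [sub_self, mul_zero, zero_mul] at this
        exact (mul_eq_zero.1 this).resolve_right (by linarith)
  · have hy2 : 2 < y.1.1 := by
      rw [sign_pos (sub_pos.2 hx2), eq_comm, sign_eq_one_iff] at h2
      linarith
    exact mem_connectedComponent_of_two_lt hx2 hy2 ht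

theorem mem_range_signs {ε s : ℝ} (hε : ε ^ 2 = 1) (hD : 0 ≤ disc s) (h2 : s ≠ 2)
    (hw : 0 < root 1 s / (s + 1)) :
    (SignType.sign ε, SignType.sign (s + 1), SignType.sign (s - 2)) ∈ range signs := by
  have h1 : s ≠ -1 := by
    rintro rfl
    simp at hw
  refine ⟨⟨branch ε 1 s, branch_mem_realLocus hε (by norm_num) h1 h2 hD hw.le⟩, ?_⟩
  simp [signs, branch, sign_mul, sign_pos (Real.sqrt_pos.2 hw)]

theorem range_signs : range signs =
    ↑({(1, -1, -1), (-1, -1, -1), (1, 1, -1), (-1, 1, -1), (1, 1, 1), (-1, 1, 1)} :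
      Finset (SignType × SignType × SignType)) := by
  apply Subset.antisymm
  · rintro _ ⟨p, rfl⟩
    have ht := (snd_ne_zero p.2).lt_or_gt
    rcases (fst_ne_two p.2).lt_or_gt with h2 | h2
    · rcases (fst_ne_neg_one p.2).lt_or_gt with h1 | h1
      · rcases ht with ht | ht <;> simp [signs, ht, sign_neg (show p.1.1 + 1 < 0 by linarith),
          sign_neg (sub_neg.2 h2)]
      · rcases ht with ht | ht <;> simp [signs, ht, sign_pos (show 0 < p.1.1 + 1 by linarith),
          sign_neg (sub_neg.2 h2)]
    · rcases ht with ht | ht <;> simp [signs, ht, sign_pos (show 0 < p.1.1 + 1 by linarith),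
          sign_pos (sub_pos.2 h2)]
  · have hA : ∀ ε : ℝ, ε ^ 2 = 1 → (SignType.sign ε, -1, -1) ∈ range signs := fun ε hε => by
      have := mem_range_signs (s := -3) hε (by norm_num [disc]) (by norm_num)
        (root_div_pos_of_lt_two (by norm_num) (by norm_num))
      rwa [sign_neg (show (-3 : ℝ) + 1 < 0 by norm_num),
        sign_neg (show (-3 : ℝ) - 2 < 0 by norm_num)] at this
    have hB : ∀ ε : ℝ, ε ^ 2 = 1 → (SignType.sign ε, 1, -1) ∈ range signs := fun ε hε => by
      have := mem_range_signs (s := 0) hε (by norm_num [disc]) (by norm_num)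
        (root_div_pos_of_lt_two (by norm_num) (by norm_num))
      rwa [sign_pos (show 0 < (0 : ℝ) + 1 by norm_num),
        sign_neg (show (0 : ℝ) - 2 < 0 by norm_num)] at this
    have hC : ∀ ε : ℝ, ε ^ 2 = 1 → (SignType.sign ε, 1, 1) ∈ range signs := fun ε hε => by
      have := mem_range_signs (s := 3) hε (by norm_num [disc]) (by norm_num)
        (root_div_pos_of_two_lt (by norm_num))
      rwa [sign_pos (show 0 < (3 : ℝ) + 1 by norm_num),
        sign_pos (show 0 < (3 : ℝ) - 2 by norm_num)] at this
    have h1 : SignType.sign (1 : ℝ) = 1 := sign_one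
    have h2 : SignType.sign (-1 : ℝ) = -1 := sign_neg (by norm_num)
    intro q hq
    simp only [Finset.coe_insert, Finset.coe_singleton, mem_insert_iff, mem_singleton_iff] at hq
    rcases hq with rfl | rfl | rfl | rfl | rfl | rfl
    · exact h1 ▸ hA 1 (by norm_num)
    · exact h2 ▸ hA (-1) (by norm_num)
    · exact h1 ▸ hB 1 (by norm_num)
    · exact h2 ▸ hB (-1) (by norm_num)
    · exact h1 ▸ hC 1 (by norm_num)
    · exact h2 ▸ hC (-1) (by norm_num)

end M137

/-- The real zero locus of `P(s,t) = (s−2)(s+1)²t⁴ − (s−2)(s+2)(s+1)t² − 1` in `ℝ²`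
has exactly six connected components. -/
theorem stmt_16 :
    Nat.card (ConnectedComponents
      {p : ℝ × ℝ // (p.1 - 2) * (p.1 + 1) ^ 2 * p.2 ^ 4 -
        (p.1 - 2) * (p.1 + 2) * (p.1 + 1) * p.2 ^ 2 - 1 = 0}) = 6 := by
  change Nat.card (ConnectedComponents M137.realLocus) = 6
  rw [natCard_connectedComponents_eq_ncard_range M137.continuous_signs
    fun _ _ => M137.mem_connectedComponent_of_signs_eq, M137.range_signs, Set.ncard_coe_finset]
  decide
end

section
/- The polynomial B(z) = z¹⁴ + 3z¹³ + 2z¹² + z¹¹ − 2z¹⁰ − 4z⁹ − z⁸ − 4z⁷ − z⁶ − 4z⁵ − 2z⁴ + z³ + 2z² + 3z + 1 has exactly six real roots, all simple, with exactly one root in each of the intervals (−2.34, −2.33), (−1.42, −1.41), (−0.71, −0.70), (−0.43, −0.42), (0.86, 0.87), and (1.15, 1.16). -/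
/-- The sextic `R` with `B z = (z ^ 2 + 1) * z ^ 6 * R (z + z⁻¹)`. -/
noncomputable def traceSextic (w : ℝ) : ℝ :=
  w ^ 6 + 3 * w ^ 5 - 5 * w ^ 4 - 17 * w ^ 3 + 2 * w ^ 2 + 19 * w + 8

/-- The derivative of `traceSextic`. -/
noncomputable def traceSexticDeriv (w : ℝ) : ℝ :=
  6 * w ^ 5 + 15 * w ^ 4 - 20 * w ^ 3 - 51 * w ^ 2 + 4 * w + 19

lemma hasDerivAt_traceSextic (w : ℝ) : HasDerivAt traceSextic (traceSexticDeriv w) w := by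
  have h := (((((hasDerivAt_pow 6 w).add ((hasDerivAt_pow 5 w).const_mul 3)).sub
    ((hasDerivAt_pow 4 w).const_mul 5)).sub ((hasDerivAt_pow 3 w).const_mul 17)).add
    ((hasDerivAt_pow 2 w).const_mul 2)).add ((hasDerivAt_id w).const_mul 19) |>.add_const 8
  refine h.congr_deriv ?_
  simp only [traceSexticDeriv]
  norm_num
  ring

lemma continuous_traceSextic : Continuous traceSextic := by
  unfold traceSextic
  fun_prop

lemma continuous_B : Continuous B := by
  unfold B
  fun_prop

lemma B_eq_traceSextic {z : ℝ} (hz : z ≠ 0) :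
    B z = (z ^ 2 + 1) * z ^ 6 * traceSextic (z + z⁻¹) := by
  simp only [B, traceSextic]
  field_simp
  ring

lemma ne_zero_of_B_eq_zero {z : ℝ} (h : B z = 0) : z ≠ 0 := by
  rintro rfl
  norm_num [B] at h

lemma B_eq_zero_iff {z : ℝ} (hz : z ≠ 0) : B z = 0 ↔ traceSextic (z + z⁻¹) = 0 := by
  have : z ^ 2 + 1 ≠ 0 := by positivity
  simp [B_eq_traceSextic hz, hz, this]

lemma B_inv_eq_zero {z : ℝ} (h : B z = 0) : B z⁻¹ = 0 := by
  have hz := ne_zero_of_B_eq_zero h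
  rw [B_eq_zero_iff (inv_ne_zero hz), inv_inv, add_comm]
  exact (B_eq_zero_iff hz).1 h

lemma traceSexticDeriv_pos_of_two_le {w : ℝ} (hw : 2 ≤ w) : 0 < traceSexticDeriv w := by
  obtain ⟨u, hu, rfl⟩ : ∃ u : ℝ, 0 ≤ u ∧ w = 2 + u := ⟨w - 2, by linarith, by ring⟩
  simp only [traceSexticDeriv]
  ring_nf
  positivity

lemma traceSexticDeriv_neg_of_le {w : ℝ} (hw : w ≤ -2.6) : traceSexticDeriv w < 0 := by
  obtain ⟨u, hu, rfl⟩ : ∃ u : ℝ, 0 ≤ u ∧ w = -2.6 - u := ⟨-2.6 - w, by linarith, by ring⟩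
  rw [← neg_pos]
  simp only [traceSexticDeriv]
  ring_nf
  positivity

lemma traceSexticDeriv_pos_of_mem_Icc {w : ℝ} (hw : w ∈ Set.Icc (-2.5 : ℝ) (-2)) :
    0 < traceSexticDeriv w := by
  obtain ⟨u, hu, rfl⟩ : ∃ u : ℝ, 0 ≤ u ∧ w = -2 - u := ⟨-2 - w, by linarith [hw.2], by ring⟩
  have hu' : u ≤ 1 / 2 := by linarith [hw.1]
  have h2 : u ^ 2 ≤ 1 / 2 * u := by nlinarith
  have h3 : u ^ 3 ≤ 1 / 2 * u ^ 2 := by nlinarith [pow_nonneg hu 2]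
  have h4 : u ^ 4 ≤ 1 / 2 * u ^ 3 := by nlinarith [pow_nonneg hu 3]
  have h5 : u ^ 5 ≤ 1 / 2 * u ^ 4 := by nlinarith [pow_nonneg hu 4]
  simp only [traceSexticDeriv]
  ring_nf
  linarith

lemma traceSextic_neg_of_mem_Icc {w : ℝ} (hw : w ∈ Set.Icc (-2.6 : ℝ) (-2.5)) :
    traceSextic w < 0 := by
  obtain ⟨u, rfl⟩ : ∃ u : ℝ, w = -2 - u := ⟨-2 - w, by ring⟩
  have hu : 1 / 2 ≤ u := by linarith [hw.2]
  have hu' : u ≤ 3 / 5 := by linarith [hw.1]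
  have h2 : (1 / 2) ^ 2 ≤ u ^ 2 := by gcongr
  have h3 : u ^ 3 ≤ (3 / 5) ^ 3 := by gcongr
  have h4 : u ^ 4 ≤ (3 / 5) ^ 4 := by gcongr
  have h5 : u ^ 5 ≤ (3 / 5) ^ 5 := by gcongr
  have h6 : u ^ 6 ≤ (3 / 5) ^ 6 := by gcongr
  simp only [traceSextic]
  ring_nf
  linarith

lemma injOn_traceSextic_Ici : Set.InjOn traceSextic (Set.Ici 2) := by
  refine (strictMonoOn_of_deriv_pos (convex_Ici _) continuous_traceSextic.continuousOn
    fun w hw ↦ ?_).injOn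
  rw [(hasDerivAt_traceSextic w).deriv]
  exact traceSexticDeriv_pos_of_two_le (interior_subset hw)

lemma injOn_traceSextic_Iic : Set.InjOn traceSextic (Set.Iic (-2.6)) := by
  refine (strictAntiOn_of_deriv_neg (convex_Iic _) continuous_traceSextic.continuousOn
    fun w hw ↦ ?_).injOn
  rw [(hasDerivAt_traceSextic w).deriv]
  exact traceSexticDeriv_neg_of_le (Set.mem_Iic.1 (interior_subset hw))

lemma injOn_traceSextic_Icc : Set.InjOn traceSextic (Set.Icc (-2.5) (-2)) := by
  refine (strictMonoOn_of_deriv_pos (convex_Icc _ _) continuous_traceSextic.continuousOn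
    fun w hw ↦ ?_).injOn
  rw [(hasDerivAt_traceSextic w).deriv]
  exact traceSexticDeriv_pos_of_mem_Icc (interior_subset hw)

lemma two_le_or_le_neg_two_add_inv {z : ℝ} (hz : z ≠ 0) : 2 ≤ z + z⁻¹ ∨ z + z⁻¹ ≤ -2 := by
  have h : z * z⁻¹ = 1 := mul_inv_cancel₀ hz
  rw [or_comm, ← le_abs', ← abs_two, ← sq_le_sq]
  nlinarith [sq_nonneg (z - z⁻¹)]

lemma add_inv_mem_of_B_eq_zero {z : ℝ} (h : B z = 0) :
    z + z⁻¹ ∈ Set.Iic (-2.6 : ℝ) ∨ z + z⁻¹ ∈ Set.Icc (-2.5 : ℝ) (-2) ∨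
      z + z⁻¹ ∈ Set.Ici (2 : ℝ) := by
  have hz := ne_zero_of_B_eq_zero h
  have hR := (B_eq_zero_iff hz).1 h
  rcases two_le_or_le_neg_two_add_inv hz with h2 | h2
  · exact Or.inr (Or.inr h2)
  rcases le_total (z + z⁻¹) (-2.6) with h3 | h3
  · exact Or.inl h3
  rcases le_total (-2.5) (z + z⁻¹) with h4 | h4
  · exact Or.inr (Or.inl ⟨h4, h2⟩)
  · exact absurd hR (traceSextic_neg_of_mem_Icc ⟨h3, h4⟩).ne

lemma eq_or_eq_inv_of_add_inv_eq {x y : ℝ} (hx : x ≠ 0) (hy : y ≠ 0)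
    (h : x + x⁻¹ = y + y⁻¹) : x = y ∨ x = y⁻¹ := by
  have key : (x - y) * (x * y - 1) = 0 := by
    field_simp at h
    linear_combination h
  rcases mul_eq_zero.1 key with h | h
  · exact Or.inl (sub_eq_zero.1 h)
  · exact Or.inr (eq_inv_of_mul_eq_one_left (sub_eq_zero.1 h))

lemma eq_or_eq_inv_of_B_eq_zero {s : Set ℝ} (hs : Set.InjOn traceSextic s) {x y : ℝ}
    (hx : B x = 0) (hy : B y = 0) (hxs : x + x⁻¹ ∈ s) (hys : y + y⁻¹ ∈ s) :
    x = y ∨ x = y⁻¹ := by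
  have hx0 := ne_zero_of_B_eq_zero hx
  have hy0 := ne_zero_of_B_eq_zero hy
  refine eq_or_eq_inv_of_add_inv_eq hx0 hy0 (hs hxs hys ?_)
  rw [(B_eq_zero_iff hx0).1 hx, (B_eq_zero_iff hy0).1 hy]

lemma deriv_B_ne_zero {z : ℝ} (h : B z = 0) : deriv B z ≠ 0 := by
  have hz := ne_zero_of_B_eq_zero h
  have hR := (B_eq_zero_iff hz).1 h
  have hw : traceSexticDeriv (z + z⁻¹) ≠ 0 := by
    rcases add_inv_mem_of_B_eq_zero h with hw | hw | hw
    · exact (traceSexticDeriv_neg_of_le hw).ne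
    · exact (traceSexticDeriv_pos_of_mem_Icc hw).ne'
    · exact (traceSexticDeriv_pos_of_two_le hw).ne'
  have hsq : 1 + -(z ^ 2)⁻¹ ≠ 0 := by
    intro hsq
    have hz2 : z ^ 2 = 1 := by
      field_simp at hsq
      linarith
    rcases sq_eq_one_iff.1 hz2 with rfl | rfl <;> norm_num [B] at h
  have hp : DifferentiableAt ℝ (fun x : ℝ ↦ (x ^ 2 + 1) * x ^ 6) z := by fun_prop
  have hd := hp.hasDerivAt.mul
    ((hasDerivAt_traceSextic (z + z⁻¹)).comp z ((hasDerivAt_id z).add (hasDerivAt_inv hz)))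
  have hB : B =ᶠ[nhds z] fun x ↦ (x ^ 2 + 1) * x ^ 6 * traceSextic (x + x⁻¹) := by
    filter_upwards [isOpen_ne.mem_nhds hz] with x hx using B_eq_traceSextic hx
  rw [(hd.congr_of_eventuallyEq hB).deriv]
  have hq : z ^ 2 + 1 ≠ 0 := by positivity
  simp only [Function.comp_apply, Pi.add_apply, id_eq, hR, mul_zero, zero_add]
  exact mul_ne_zero (mul_ne_zero hq (pow_ne_zero 6 hz)) (mul_ne_zero hw hsq)

/-- `B` has exactly six real roots, all simple, located one in each of the intervals
`(−2.34, −2.33)`, `(−1.42, −1.41)`, `(−0.71, −0.70)`, `(−0.43, −0.42)`,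
`(0.86, 0.87)`, `(1.15, 1.16)`. -/
theorem stmt_17 :
    ∃ z₁ z₂ z₃ z₄ z₅ z₆ : ℝ,
      z₁ ∈ Set.Ioo (-2.34 : ℝ) (-2.33) ∧
      z₂ ∈ Set.Ioo (-1.42 : ℝ) (-1.41) ∧
      z₃ ∈ Set.Ioo (-0.71 : ℝ) (-0.70) ∧
      z₄ ∈ Set.Ioo (-0.43 : ℝ) (-0.42) ∧
      z₅ ∈ Set.Ioo (0.86 : ℝ) 0.87 ∧
      z₆ ∈ Set.Ioo (1.15 : ℝ) 1.16 ∧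
      B z₁ = 0 ∧ B z₂ = 0 ∧ B z₃ = 0 ∧ B z₄ = 0 ∧ B z₅ = 0 ∧ B z₆ = 0 ∧
      (∀ z : ℝ, B z = 0 → z = z₁ ∨ z = z₂ ∨ z = z₃ ∨ z = z₄ ∨ z = z₅ ∨ z = z₆) ∧
      (∀ z : ℝ, B z = 0 → deriv B z ≠ 0) := by
  obtain ⟨x, hx, hBx⟩ : (0 : ℝ) ∈ B '' Set.Ioo (-2.34) (-2.33) :=
    intermediate_value_Ioo' (by norm_num) continuous_B.continuousOn
      ⟨by norm_num [B], by norm_num [B]⟩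
  obtain ⟨y, hy, hBy⟩ : (0 : ℝ) ∈ B '' Set.Ioo (-1.42) (-1.41) :=
    intermediate_value_Ioo (by norm_num) continuous_B.continuousOn
      ⟨by norm_num [B], by norm_num [B]⟩
  obtain ⟨t, ht, hBt⟩ : (0 : ℝ) ∈ B '' Set.Ioo 1.15 1.16 :=
    intermediate_value_Ioo (by norm_num) continuous_B.continuousOn
      ⟨by norm_num [B], by norm_num [B]⟩
  have hx' : x⁻¹ ∈ Set.Ioo (-0.43 : ℝ) (-0.42) := by
    have := mul_inv_cancel₀ (ne_zero_of_B_eq_zero hBx)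
    constructor <;> nlinarith [hx.1, hx.2]
  have hy' : y⁻¹ ∈ Set.Ioo (-0.71 : ℝ) (-0.70) := by
    have := mul_inv_cancel₀ (ne_zero_of_B_eq_zero hBy)
    constructor <;> nlinarith [hy.1, hy.2]
  have ht' : t⁻¹ ∈ Set.Ioo (0.86 : ℝ) 0.87 := by
    have := mul_inv_cancel₀ (ne_zero_of_B_eq_zero hBt)
    constructor <;> nlinarith [ht.1, ht.2]
  refine ⟨x, y, y⁻¹, x⁻¹, t⁻¹, t, hx, hy, hy', hx', ht', ht, hBx, hBy, B_inv_eq_zero hBy,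
    B_inv_eq_zero hBx, B_inv_eq_zero hBt, hBt, fun z hz ↦ ?_, fun z hz ↦ deriv_B_ne_zero hz⟩
  rcases add_inv_mem_of_B_eq_zero hz with hw | hw | hw
  · have := eq_or_eq_inv_of_B_eq_zero injOn_traceSextic_Iic hz hBx hw
      (Set.mem_Iic.2 (by linarith [hx.2, hx'.2]))
    tauto
  · have := eq_or_eq_inv_of_B_eq_zero injOn_traceSextic_Icc hz hBy hw
      ⟨by linarith [hy.1, hy'.1], by linarith [hy.2, hy'.2]⟩
    tauto
  · have := eq_or_eq_inv_of_B_eq_zero injOn_traceSextic_Ici hz hBt hw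
      (Set.mem_Ici.2 (by linarith [ht.1, ht'.1]))
    tauto
end

section
/- Let p₁ be the smallest real root of the cubic s³ + 2s² − 4s − 4. For every real number s with either s > 2 or s ≤ p₁, there exists a real number t > 0 such that P(s,t) = 0. -/
/-- A quadratic with nonnegative discriminant whose formula root is positive
has a root that is the square of a positive number. -/
theorem exists_pos_biquadratic_root {a b r : ℝ} (ha : a ≠ 0)
    (hr : r ^ 2 = b ^ 2 + 4 * a) (hpos : 0 < (b + r) / (2 * a)) :
    ∃ t : ℝ, 0 < t ∧ a * t ^ 4 - b * t ^ 2 - 1 = 0 := by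
  refine ⟨√((b + r) / (2 * a)), Real.sqrt_pos.2 hpos, ?_⟩
  have h4 : √((b + r) / (2 * a)) ^ 4 = ((b + r) / (2 * a)) ^ 2 := by
    rw [show 4 = 2 * 2 from rfl, pow_mul, Real.sq_sqrt hpos.le]
  rw [h4, Real.sq_sqrt hpos.le]
  field_simp
  linear_combination hr

/-- The smallest real root of `s³ + 2s² − 4s − 4` is less than `-2`. -/
theorem smallest_root_lt_neg_two {p : ℝ}
    (hmin : ∀ x : ℝ, x ^ 3 + 2 * x ^ 2 - 4 * x - 4 = 0 → p ≤ x) : p < -2 := by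
  have hcont : ContinuousOn (fun x : ℝ => x ^ 3 + 2 * x ^ 2 - 4 * x - 4) (Set.Icc (-3) (-2)) := by
    fun_prop
  obtain ⟨x, hx, hx0⟩ := intermediate_value_Ico (by norm_num) hcont
    (show (0 : ℝ) ∈ Set.Ico _ _ by norm_num)
  exact (hmin x hx0).trans_lt hx.2

/-- Let `p₁` be the smallest real root of `s³ + 2s² − 4s − 4`. For every real `s`
with `s > 2` or `s ≤ p₁`, there exists a real `t > 0` with
`(s−2)(s+1)²t⁴ − (s−2)(s+2)(s+1)t² − 1 = 0`. -/
theorem stmt_18 (p₁ : ℝ)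
    (hroot : p₁ ^ 3 + 2 * p₁ ^ 2 - 4 * p₁ - 4 = 0)
    (hmin : ∀ x : ℝ, x ^ 3 + 2 * x ^ 2 - 4 * x - 4 = 0 → p₁ ≤ x)
    (s : ℝ) (hs : 2 < s ∨ s ≤ p₁) :
    ∃ t : ℝ, 0 < t ∧
      (s - 2) * (s + 1) ^ 2 * t ^ 4 - (s - 2) * (s + 2) * (s + 1) * t ^ 2 - 1 = 0 := by
  rcases hs with hs | hs
  · have h2 : 0 < s - 2 := by linarith
    have ha : 0 < (s - 2) * (s + 1) ^ 2 := by positivity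
    have hb : 0 < (s - 2) * (s + 2) * (s + 1) := by positivity
    exact exists_pos_biquadratic_root ha.ne' (Real.sq_sqrt (by positivity)) (by positivity)
  · have hp := smallest_root_lt_neg_two hmin
    have h2 : s - 2 < 0 := by linarith
    have ha : (s - 2) * (s + 1) ^ 2 < 0 :=
      mul_neg_of_neg_of_pos h2 (sq_pos_of_neg (by linarith))
    have hb : (s - 2) * (s + 2) * (s + 1) < 0 :=
      mul_neg_of_pos_of_neg (mul_pos_of_neg_of_neg h2 (by linarith)) (by linarith)
    have hcubic : s ^ 3 + 2 * s ^ 2 - 4 * s - 4 ≤ 0 := by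
      have hq : 0 ≤ s ^ 2 + s * p₁ + p₁ ^ 2 + 2 * (s + p₁) - 4 := by nlinarith
      linear_combination hroot + mul_nonneg (sub_nonneg.2 hs) hq
    have hD : 0 ≤ ((s - 2) * (s + 2) * (s + 1)) ^ 2 + 4 * ((s - 2) * (s + 1) ^ 2) := by
      linear_combination mul_nonneg (mul_nonneg_of_nonpos_of_nonpos h2.le hcubic) (sq_nonneg (s + 1))
    refine exists_pos_biquadratic_root ha.ne ((neg_sq _).trans (Real.sq_sqrt hD))
      (div_pos_of_neg_of_neg ?_ (by linarith))
    linarith [Real.sqrt_nonneg (((s - 2) * (s + 2) * (s + 1)) ^ 2 + 4 * ((s - 2) * (s + 1) ^ 2))]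
end
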